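/- arXiv:2502.12798 — 4 statements merged into one kernel-verified Lean document; each statement's English description precedes it below -/
import Mathlib

section
/- There exists an absolute constant c > 0 (independent of all other data) with the following property: for every probability space with a filtration (F_t)_{t=0}^T, every integer T ≥ 1, and every martingale (M_t)_{t=0}^T with M_0 = 0 whose increments D_t = M_t − M_{t−1} satisfy |D_t| ≤ 1 almost surely, if Σ_{t=1}^T E[D_t²] ≥ √T and Var( Σ_{t=1}^T D_t² ) ≤ T, then E[ max_{0≤t≤T} |M_t| ] ≥ c · √( Σ_{t=1}^T E[D_t²] ). -/
open MeasureTheory ProbabilityTheory Finset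

/-- Polynomial core of the one-step estimate. -/
lemma core_step (x y m m' A B : ℝ) (hA : 0 ≤ A) (hAB : A ≤ B) (hmA : m ≤ A)
    (hx : |x| ≤ m) (hm' : m' = max m |y|)
    (hB : B ^ 2 = A ^ 2 + (y - x) ^ 2 + m' ^ 2 - m ^ 2) :
    2 * x * (y - x) ≤ 6 * A * (m' - m) - 2 * A * (B - A) + y ^ 2 - m' ^ 2 - x ^ 2 + m ^ 2 := by
  have hm0 : 0 ≤ m := (abs_nonneg x).trans hx
  suffices h : 2 * (m' ^ 2 - m ^ 2) ≤ 6 * A * (m' - m) + (B - A) ^ 2 by nlinarith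
  rcases le_total |y| m with h | h
  · rw [max_eq_left h] at hm'
    subst hm'
    nlinarith [sq_nonneg (B - A)]
  · rw [max_eq_right h] at hm'
    obtain ⟨e, he⟩ : ∃ e, m' = m + e := ⟨m' - m, by ring⟩
    have he0 : 0 ≤ e := by linarith
    have hd : e ≤ |y - x| := by
      have := abs_sub_abs_le_abs_sub y x
      linarith
    have hd2 : e ^ 2 ≤ (y - x) ^ 2 := by
      rw [← sq_abs (y - x)]
      exact pow_le_pow_left₀ he0 hd 2
    subst he
    have hB2 : A ^ 2 + 2 * e ^ 2 + 2 * m * e ≤ B ^ 2 := by nlinarith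
    have hme : m * e ≤ A * e := mul_le_mul_of_nonneg_right hmA he0
    rcases le_total B (A + 2 * e) with h2 | h2
    · nlinarith [mul_le_mul_of_nonneg_left h2 hA]
    · have : (2 * e) ^ 2 ≤ (B - A) ^ 2 := pow_le_pow_left₀ (by linarith) (by linarith) 2
      nlinarith

/-- Running maximum. -/
noncomputable def runMax (x : ℕ → ℝ) : ℕ → ℝ
  | 0 => 0
  | n + 1 => max (runMax x n) |x (n + 1)|

/-- Quadratic variation. -/
noncomputable def quadVar (x : ℕ → ℝ) : ℕ → ℝ
  | 0 => 0
  | n + 1 => quadVar x n + (x (n + 1) - x n) ^ 2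

noncomputable def aux (x : ℕ → ℝ) (n : ℕ) : ℝ := Real.sqrt (quadVar x n + runMax x n ^ 2)

lemma quadVar_nonneg (x : ℕ → ℝ) (n : ℕ) : 0 ≤ quadVar x n := by
  induction n with
  | zero => simp [quadVar]
  | succ n ih => rw [quadVar]; positivity

lemma runMax_nonneg (x : ℕ → ℝ) (n : ℕ) : 0 ≤ runMax x n := by
  induction n with
  | zero => simp [runMax]
  | succ n ih => rw [runMax]; exact le_max_of_le_left ih

lemma abs_le_runMax (x : ℕ → ℝ) (h0 : x 0 = 0) (n : ℕ) : |x n| ≤ runMax x n := by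
  cases n with
  | zero => simp [runMax, h0]
  | succ n => rw [runMax]; exact le_max_right _ _

lemma runMax_le_aux (x : ℕ → ℝ) (n : ℕ) : runMax x n ≤ aux x n :=
  Real.le_sqrt_of_sq_le (by linarith [quadVar_nonneg x n])

lemma aux_sq (x : ℕ → ℝ) (n : ℕ) : aux x n ^ 2 = quadVar x n + runMax x n ^ 2 :=
  Real.sq_sqrt (by have := quadVar_nonneg x n; positivity)

/-- Pathwise Davis inequality (Beiglböck–Siorpaes). -/
lemma pathwise (x : ℕ → ℝ) (h0 : x 0 = 0) (n : ℕ) :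
    ∑ k ∈ range n, x k / aux x k * (x (k + 1) - x k) ≤
      3 * runMax x n - aux x n + (x n ^ 2 - runMax x n ^ 2) / (2 * aux x n) := by
  induction n with
  | zero => simp [runMax, quadVar, aux, h0]
  | succ n ih =>
    rw [sum_range_succ]
    have hx := abs_le_runMax x h0 n
    have hy := abs_le_runMax x h0 (n + 1)
    have hA := runMax_le_aux x n
    have hm := runMax_nonneg x n
    have hm' := runMax_nonneg x (n + 1)
    have hA2 := aux_sq x n
    have hB2 := aux_sq x (n + 1)
    have hq : quadVar x (n + 1) = quadVar x n + (x (n + 1) - x n) ^ 2 := rfl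
    have hr : runMax x (n + 1) = max (runMax x n) |x (n + 1)| := rfl
    have hmm : runMax x n ≤ runMax x (n + 1) := by rw [hr]; exact le_max_left _ _
    have hAB : aux x n ≤ aux x (n + 1) := by
      apply Real.sqrt_le_sqrt
      rw [hq]
      nlinarith [sq_nonneg (x (n + 1) - x n)]
    have hA0 : 0 ≤ aux x n := Real.sqrt_nonneg _
    have hc := core_step (x n) (x (n + 1)) (runMax x n) (runMax x (n + 1)) (aux x n)
      (aux x (n + 1)) hA0 hAB hA hx hr (by rw [hB2, hA2, hq]; ring)
    have hle : x (n + 1) ^ 2 - runMax x (n + 1) ^ 2 ≤ 0 := by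
      have := pow_le_pow_left₀ (abs_nonneg _) hy 2
      rw [sq_abs] at this
      linarith
    generalize aux x n = A at *
    generalize aux x (n + 1) = B at *
    generalize runMax x n = m at *
    generalize hm2 : runMax x (n + 1) = m' at *
    rcases hA0.eq_or_lt with hz | hpos
    · subst hz
      have : m = 0 := le_antisymm hA hm
      subst this
      have hx0 : x n = 0 := abs_eq_zero.1 (le_antisymm hx (abs_nonneg _))
      have hq0 : quadVar x n = 0 := by linarith
      have hr' : m' = |x (n + 1)| := by rw [hr]; exact max_eq_right (abs_nonneg _)
      have h3 : m' ^ 2 = x (n + 1) ^ 2 := by rw [hr', sq_abs]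
      rw [hq, hq0, hx0] at hB2
      rw [h3, sub_self, zero_div]
      simp only [div_zero, zero_mul, mul_zero, sub_zero, add_zero] at ih ⊢
      have : B ≤ 3 * m' := by
        refine abs_le_of_sq_le_sq' ?_ (by positivity) |>.2
        nlinarith
      linarith
    · have h4 : (x (n + 1) ^ 2 - m' ^ 2) / (2 * A) ≤ (x (n + 1) ^ 2 - m' ^ 2) / (2 * B) := by
        have hBp : 0 < B := by linarith
        rw [div_le_div_iff₀ (by positivity) (by positivity)]
        nlinarith
      have h5 : x n / A * (x (n + 1) - x n) ≤ 3 * (m' - m) - (B - A) +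
          (x (n + 1) ^ 2 - m' ^ 2) / (2 * A) - (x n ^ 2 - m ^ 2) / (2 * A) := by
        have e : 3 * (m' - m) - (B - A) +
          (x (n + 1) ^ 2 - m' ^ 2) / (2 * A) - (x n ^ 2 - m ^ 2) / (2 * A) -
            x n / A * (x (n + 1) - x n) = (6 * A * (m' - m) - 2 * A * (B - A) + x (n + 1) ^ 2
            - m' ^ 2 - x n ^ 2 + m ^ 2 - 2 * x n * (x (n + 1) - x n)) / (2 * A) := by
          field_simp
          ring
        have : 0 ≤ (6 * A * (m' - m) - 2 * A * (B - A) + x (n + 1) ^ 2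
            - m' ^ 2 - x n ^ 2 + m ^ 2 - 2 * x n * (x (n + 1) - x n)) / (2 * A) :=
          div_nonneg (by linarith) (by positivity)
        linarith
      linarith

lemma pathwise' (x : ℕ → ℝ) (h0 : x 0 = 0) (n : ℕ) :
    Real.sqrt (quadVar x n) ≤
      3 * runMax x n - ∑ k ∈ range n, x k / aux x k * (x (k + 1) - x k) := by
  have h1 := pathwise x h0 n
  have h2 : Real.sqrt (quadVar x n) ≤ aux x n := Real.sqrt_le_sqrt (by nlinarith [sq_nonneg (runMax x n)])
  have h3 : (x n ^ 2 - runMax x n ^ 2) / (2 * aux x n) ≤ 0 := by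
    apply div_nonpos_of_nonpos_of_nonneg
    · have := pow_le_pow_left₀ (abs_nonneg _) (abs_le_runMax x h0 n) 2
      rw [sq_abs] at this
      linarith
    · have : 0 ≤ aux x n := Real.sqrt_nonneg _
      positivity
  linarith

lemma abs_h_le (x : ℕ → ℝ) (h0 : x 0 = 0) (n : ℕ) : |x n / aux x n| ≤ 1 := by
  have h : 0 ≤ aux x n := Real.sqrt_nonneg _
  rw [abs_div, abs_of_nonneg h]
  exact div_le_one_of_le₀ ((abs_le_runMax x h0 n).trans (runMax_le_aux x n)) h

lemma tangent (V s : ℝ) (hV : 0 < V) (hs : 0 ≤ s) :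
    Real.sqrt V * (3 * (s / V) - s ^ 2 / V ^ 2) / 2 ≤ Real.sqrt s := by
  set u := Real.sqrt (s / V) with hu
  have hu0 : 0 ≤ u := Real.sqrt_nonneg _
  have hu2 : s / V = u ^ 2 := (Real.sq_sqrt (by positivity)).symm
  have : Real.sqrt s = Real.sqrt V * u := by
    rw [hu, ← Real.sqrt_mul hV.le]
    congr 1
    field_simp
  rw [this, ← div_pow, hu2, mul_div_assoc]
  apply mul_le_mul_of_nonneg_left _ (Real.sqrt_nonneg _)
  nlinarith [mul_nonneg hu0 (mul_nonneg (sq_nonneg (u - 1)) (by linarith : 0 ≤ u + 2))]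

lemma sum_eq_quadVar (x : ℕ → ℝ) (T : ℕ) :
    ∑ t ∈ Finset.Icc 1 T, (x t - x (t - 1)) ^ 2 = quadVar x T := by
  induction T with
  | zero => simp [quadVar]
  | succ n ih => rw [Finset.sum_Icc_succ_top (by omega), ih]; rfl

lemma runMax_le_iSup (x : ℕ → ℝ) (T n : ℕ) (hn : n ≤ T) :
    runMax x n ≤ ⨆ t : Fin (T + 1), |x t| := by
  have hb : BddAbove (Set.range fun t : Fin (T + 1) => |x t|) := (Set.finite_range _).bddAbove
  induction n with
  | zero => exact Real.iSup_nonneg (fun _ => abs_nonneg _)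
  | succ n ih =>
    exact max_le (ih (by omega)) (le_ciSup hb (⟨n + 1, by omega⟩ : Fin (T + 1)))

section
variable {Ω : Type} {mΩ : MeasurableSpace Ω} {P : Measure Ω} {ℱ : Filtration ℕ mΩ}
  {M : ℕ → Ω → ℝ}

lemma meas_M (hM : Martingale M ℱ P) {k n : ℕ} (h : k ≤ n) : Measurable[ℱ n] (M k) :=
  ((hM.stronglyAdapted k).mono (ℱ.mono h)).measurable

lemma meas_runMax (hM : Martingale M ℱ P) (k n : ℕ) (h : k ≤ n) :
    Measurable[ℱ n] (fun ω => runMax (fun t => M t ω) k) := by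
  induction k with
  | zero => exact measurable_const
  | succ k ih =>
    have h1 := ih (by omega)
    have h2 := meas_M hM h
    simp only [runMax]
    exact Measurable.max h1 (measurable_norm.comp h2)

lemma meas_quadVar (hM : Martingale M ℱ P) (k n : ℕ) (h : k ≤ n) :
    Measurable[ℱ n] (fun ω => quadVar (fun t => M t ω) k) := by
  induction k with
  | zero => exact measurable_const
  | succ k ih =>
    have h1 := ih (by omega)
    have h2 := meas_M hM h
    have h3 := meas_M hM (show k ≤ n by omega)
    simp only [quadVar]
    exact h1.add ((h2.sub h3).pow_const 2)

lemma meas_h (hM : Martingale M ℱ P) (n : ℕ) :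
    Measurable[ℱ n] (fun ω => M n ω / aux (fun t => M t ω) n) := by
  have h1 := meas_runMax hM n n le_rfl
  have h2 := meas_quadVar hM n n le_rfl
  exact (meas_M hM le_rfl).div ((h2.add (h1.pow_const 2)).sqrt)

lemma integrable_h [IsProbabilityMeasure P] (hM : Martingale M ℱ P) (h0 : M 0 = 0) (n : ℕ) :
    Integrable (fun ω => M n ω / aux (fun t => M t ω) n * (M (n + 1) ω - M n ω)) P := by
  have hD : Integrable (fun ω => M (n + 1) ω - M n ω) P :=
    (hM.integrable (n + 1)).sub (hM.integrable n)
  refine hD.bdd_mul (c := 1) ((meas_h hM n).mono (ℱ.le n) le_rfl).aestronglyMeasurable ?_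
  refine Filter.Eventually.of_forall fun ω => ?_
  exact abs_h_le (fun t => M t ω) (by simp [h0]) n

lemma integral_h [IsProbabilityMeasure P] (hM : Martingale M ℱ P) (h0 : M 0 = 0) (n : ℕ) :
    ∫ ω, M n ω / aux (fun t => M t ω) n * (M (n + 1) ω - M n ω) ∂P = 0 := by
  have hD : Integrable (M (n + 1) - M n) P :=
    (hM.integrable (n + 1)).sub (hM.integrable n)
  have hi := integrable_h hM h0 n
  have h1 := condExp_mul_of_stronglyMeasurable_left (m := ℱ n) (μ := P)
    (meas_h hM n).stronglyMeasurable hi hD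
  have h2 : P[M (n + 1) - M n | ℱ n] =ᵐ[P] 0 := by
    have a := condExp_sub (hM.integrable (n + 1)) (hM.integrable n) (ℱ n)
    have b := hM.condExp_ae_eq (Nat.le_succ n)
    have c := hM.condExp_ae_eq (le_refl n)
    filter_upwards [a, b, c] with ω ha hb hc
    rw [ha]
    simp only [Pi.sub_apply, Pi.zero_apply]
    rw [hc]
    rw [Nat.succ_eq_add_one] at hb
    rw [hb, sub_self]
  have h3 : ∫ ω, M n ω / aux (fun t => M t ω) n * (M (n + 1) ω - M n ω) ∂P
      = ∫ ω, (P[(fun ω => M n ω / aux (fun t => M t ω) n) * (M (n + 1) - M n) | ℱ n]) ω ∂P :=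
    (integral_condExp (ℱ.le n)).symm
  rw [h3]
  apply integral_eq_zero_of_ae
  filter_upwards [h1, h2] with ω ha hb
  refine ha.trans ?_
  have hb' : (P[fun ω => M (n + 1) ω - M n ω | ℱ n]) ω = 0 := hb
  rw [Pi.mul_apply, hb']
  simp

end

/-- **Theorem 3.8 (abstract martingale form of the envy lower bound).** There is an
absolute constant `c > 0` such that for every martingale `(M t)_{t=0}^T` with
`M 0 = 0` and increments `D t = M t − M (t−1)` bounded by `1`, if
`∑_{t=1}^T E[D t²] ≥ √T` and `Var (∑_{t=1}^T D t²) ≤ T`, then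
`E[max_{0 ≤ t ≤ T} |M t|] ≥ c √(∑_{t=1}^T E[D t²])`. -/
theorem stmt_4 :
    ∃ c : ℝ, 0 < c ∧
      ∀ (Ω : Type) (mΩ : MeasurableSpace Ω) (P : @Measure Ω mΩ),
        @IsProbabilityMeasure Ω mΩ P →
        ∀ (T : ℕ), 1 ≤ T →
        ∀ (ℱ : @Filtration Ω ℕ _ mΩ) (M : ℕ → Ω → ℝ),
          Martingale M ℱ P → M 0 = 0 →
          (∀ t, 1 ≤ t → t ≤ T → ∀ᵐ ω ∂P, |M t ω - M (t - 1) ω| ≤ 1) →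
          (Real.sqrt T ≤
            ∑ t ∈ Finset.Icc 1 T, ∫ ω, (M t ω - M (t - 1) ω) ^ 2 ∂P) →
          (variance (fun ω => ∑ t ∈ Finset.Icc 1 T, (M t ω - M (t - 1) ω) ^ 2) P
            ≤ T) →
          c * Real.sqrt
              (∑ t ∈ Finset.Icc 1 T, ∫ ω, (M t ω - M (t - 1) ω) ^ 2 ∂P) ≤
            ∫ ω, (⨆ t : Fin (T + 1), |M t ω|) ∂P := by
  refine ⟨1 / 6, by norm_num, ?_⟩
  intro Ω mΩ P hP T hT ℱ M hM h0 hb hV hvar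
  set V := ∑ t ∈ Finset.Icc 1 T, ∫ ω, (M t ω - M (t - 1) ω) ^ 2 ∂P with hVdef
  set S : Ω → ℝ := fun ω => ∑ t ∈ Finset.Icc 1 T, (M t ω - M (t - 1) ω) ^ 2 with hS
  have hSq : ∀ ω, S ω = quadVar (fun t => M t ω) T := fun ω =>
    sum_eq_quadVar (fun t => M t ω) T
  have hMm : ∀ t, Measurable (M t) := fun t => (meas_M hM le_rfl).mono (ℱ.le t) le_rfl
  have hDm : ∀ t, Measurable (fun ω => (M t ω - M (t - 1) ω) ^ 2) := fun t =>
    ((hMm t).sub (hMm (t - 1))).pow_const 2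
  have hSm : Measurable S := Finset.measurable_sum _ fun t _ => hDm t
  have hDb : ∀ t ∈ Finset.Icc 1 T, ∀ᵐ ω ∂P, ‖(M t ω - M (t - 1) ω) ^ 2‖ ≤ 1 := by
    intro t ht
    rw [Finset.mem_Icc] at ht
    filter_upwards [hb t ht.1 ht.2] with ω hω
    rw [Real.norm_eq_abs, abs_of_nonneg (sq_nonneg _), sq_le_one_iff_abs_le_one]
    exact hω
  have hDL : ∀ t ∈ Finset.Icc 1 T, MemLp (fun ω => (M t ω - M (t - 1) ω) ^ 2) 2 P :=
    fun t ht => MemLp.of_bound (hDm t).aestronglyMeasurable 1 (hDb t ht)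
  have hSL : MemLp S 2 P := memLp_finsetSum _ hDL
  have hSi : Integrable S P := hSL.integrable (by norm_num)
  have hS2i : Integrable (fun ω => S ω ^ 2) P := hSL.integrable_sq
  have hES : ∫ ω, S ω ∂P = V :=
    integral_finsetSum _ fun t ht => (hDL t ht).integrable (by norm_num)
  have hT1 : (1 : ℝ) ≤ T := by exact_mod_cast hT
  have hVpos : 0 < V := lt_of_lt_of_le (Real.sqrt_pos.2 (by linarith)) hV
  have hTV : (T : ℝ) ≤ V ^ 2 := by
    rw [← Real.sqrt_le_left hVpos.le]
    exact hV
  have hES2 : ∫ ω, S ω ^ 2 ∂P ≤ 2 * V ^ 2 := by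
    have h := variance_eq_sub hSL
    have h' : P[S ^ 2] = ∫ ω, S ω ^ 2 ∂P := rfl
    rw [h', hES] at h
    linarith
  have hsupm : Measurable (fun ω => ⨆ t : Fin (T + 1), |M t ω|) :=
    Measurable.iSup fun t => by simpa only [Real.norm_eq_abs] using (hMm t).norm
  have hsupi : Integrable (fun ω => ⨆ t : Fin (T + 1), |M t ω|) P := by
    have hsum : Integrable (fun ω => ∑ t : Fin (T + 1), |M t ω|) P :=
      integrable_finsetSum _ fun t _ => (hM.integrable t).abs
    refine hsum.mono' hsupm.aestronglyMeasurable (Filter.Eventually.of_forall fun ω => ?_)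
    rw [Real.norm_eq_abs, abs_of_nonneg (Real.iSup_nonneg fun _ => abs_nonneg _)]
    exact ciSup_le fun t =>
      Finset.single_le_sum (f := fun t : Fin (T + 1) => |M t ω|)
        (fun _ _ => abs_nonneg _) (Finset.mem_univ t)
  have hpt : ∀ ω, Real.sqrt V * (3 * (S ω / V) - S ω ^ 2 / V ^ 2) / 2 ≤
      3 * (⨆ t : Fin (T + 1), |M t ω|) -
        ∑ k ∈ range T, M k ω / aux (fun t => M t ω) k * (M (k + 1) ω - M k ω) := by
    intro ω
    have h1 := pathwise' (fun t => M t ω) (by simp [h0]) T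
    have h2 := tangent V (S ω) hVpos (by rw [hSq]; exact quadVar_nonneg _ _)
    have h3 := runMax_le_iSup (fun t => M t ω) T T le_rfl
    rw [← hSq ω] at h1
    linarith
  have hHi : Integrable (fun ω => ∑ k ∈ range T,
      M k ω / aux (fun t => M t ω) k * (M (k + 1) ω - M k ω)) P :=
    integrable_finsetSum _ fun k _ => integrable_h hM h0 k
  have hL1 : Integrable (fun ω => 3 * (S ω / V)) P := (hSi.div_const V).const_mul 3
  have hL2 : Integrable (fun ω => S ω ^ 2 / V ^ 2) P := hS2i.div_const _
  have hint := integral_mono (((hL1.sub hL2).const_mul (Real.sqrt V)).div_const 2)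
    ((hsupi.const_mul 3).sub hHi) hpt
  have hR : ∫ ω, (3 * (⨆ t : Fin (T + 1), |M t ω|) -
        ∑ k ∈ range T, M k ω / aux (fun t => M t ω) k * (M (k + 1) ω - M k ω)) ∂P
      = 3 * ∫ ω, (⨆ t : Fin (T + 1), |M t ω|) ∂P := by
    rw [integral_sub (hsupi.const_mul 3) hHi, integral_const_mul,
      integral_finsetSum _ fun k _ => integrable_h hM h0 k,
      Finset.sum_eq_zero fun k _ => integral_h hM h0 k, sub_zero]
  have hLe : ∫ ω, Real.sqrt V * (3 * (S ω / V) - S ω ^ 2 / V ^ 2) / 2 ∂P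
      = Real.sqrt V * (3 * (V / V) - (∫ ω, S ω ^ 2 ∂P) / V ^ 2) / 2 := by
    rw [integral_div, integral_const_mul, integral_sub hL1 hL2, integral_const_mul,
      integral_div, integral_div, hES]
  have hfin : Real.sqrt V * (3 * (V / V) - (∫ ω, S ω ^ 2 ∂P) / V ^ 2) / 2 ≤
      3 * ∫ ω, (⨆ t : Fin (T + 1), |M t ω|) ∂P := by
    rw [← hLe, ← hR]
    exact hint
  have hq : (∫ ω, S ω ^ 2 ∂P) / V ^ 2 ≤ 2 := by
    rw [div_le_iff₀ (by positivity)]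
    exact hES2
  rw [div_self hVpos.ne'] at hfin
  have hsq : 0 ≤ Real.sqrt V := Real.sqrt_nonneg _
  have := mul_le_mul_of_nonneg_left hq hsq
  linarith
end

section
/- Let Y be a nonnegative real random variable with finite second moment and E[Y] > 0. Then E[√Y] ≥ √(E[Y]) · ( 1 − Var(Y) / (2 (E[Y])²) ). -/
open MeasureTheory ProbabilityTheory

/-- **Proposition 3.10 (reverse-Jensen inequality for the square root).**
If `Y ≥ 0` has a finite second moment and `E[Y] > 0`, then
`E[√Y] ≥ √(E[Y]) (1 − Var Y / (2 E[Y]²))`. -/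
theorem stmt_5
    {Ω : Type*} [MeasurableSpace Ω] (P : Measure Ω) [IsProbabilityMeasure P]
    (Y : Ω → ℝ)
    (hnn : ∀ᵐ ω ∂P, 0 ≤ Y ω)
    (hint : Integrable Y P)
    (hint2 : Integrable (fun ω => (Y ω) ^ 2) P)
    (hpos : 0 < ∫ ω, Y ω ∂P) :
    Real.sqrt (∫ ω, Y ω ∂P) *
        (1 - variance Y P / (2 * (∫ ω, Y ω ∂P) ^ 2)) ≤
      ∫ ω, Real.sqrt (Y ω) ∂P := by
  have hsq : Integrable (fun ω => Real.sqrt (Y ω)) P := by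
    refine Integrable.mono' (hint.norm.add (integrable_const (1 : ℝ)))
      (Real.continuous_sqrt.comp_aestronglyMeasurable hint.1) ?_
    filter_upwards [hnn] with ω h
    have h1 := Real.sq_sqrt h
    simp only [Real.norm_eq_abs, abs_of_nonneg (Real.sqrt_nonneg _), Pi.add_apply, abs_of_nonneg h]
    nlinarith [sq_nonneg (Real.sqrt (Y ω) - 1), Real.sqrt_nonneg (Y ω)]
  have hL : MemLp Y 2 P := (memLp_two_iff_integrable_sq hint.1).2 hint2
  have hv : variance Y P = (∫ ω, (Y ω) ^ 2 ∂P) - (∫ ω, Y ω ∂P) ^ 2 := by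
    rw [variance_eq_sub hL]; rfl
  rw [hv]
  set m := ∫ ω, Y ω ∂P with hm
  set r := Real.sqrt m with hr
  have hr0 : 0 < r := Real.sqrt_pos.2 hpos
  have hrm : m = r ^ 2 := (Real.sq_sqrt hpos.le).symm
  have key : ∫ ω, (3 / (2 * r) * Y ω - 1 / (2 * r ^ 3) * (Y ω) ^ 2) ∂P
      ≤ ∫ ω, Real.sqrt (Y ω) ∂P := by
    refine integral_mono_ae ((hint.const_mul _).sub (hint2.const_mul _)) hsq ?_
    filter_upwards [hnn] with ω h
    have h1 := Real.sq_sqrt h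
    have h0 := Real.sqrt_nonneg (Y ω)
    generalize Real.sqrt (Y ω) = s at *
    rw [← h1]
    have e : s - (3 / (2 * r) * s ^ 2 - 1 / (2 * r ^ 3) * (s ^ 2) ^ 2)
        = s * (s - r) ^ 2 * (s + 2 * r) / (2 * r ^ 3) := by
      field_simp
      ring
    have : 0 ≤ s * (s - r) ^ 2 * (s + 2 * r) / (2 * r ^ 3) := by positivity
    linarith
  rw [integral_sub (hint.const_mul _) (hint2.const_mul _), integral_const_mul,
    integral_const_mul, ← hm] at key
  refine le_trans (le_of_eq ?_) key
  generalize ∫ ω, (Y ω) ^ 2 ∂P = q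
  clear_value r m
  subst hrm
  field_simp
  ring
end

section
/- Let T > 0 be a real number and let Y be a nonnegative real random variable with finite second moment such that E[Y] ≥ √T and Var(Y) ≤ T. Then E[√Y] ≥ (1/2) · √(E[Y]). -/
open MeasureTheory ProbabilityTheory

/-- **Inequalities (8)–(10) in the proof of Theorem 3.8.** If `Y ≥ 0` has a finite
second moment, `E[Y] ≥ √T` and `Var Y ≤ T` for some real `T > 0`, then
`E[√Y] ≥ (1/2) √(E[Y])`. -/
theorem stmt_6
    {Ω : Type*} [MeasurableSpace Ω] (P : Measure Ω) [IsProbabilityMeasure P]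
    (T : ℝ) (hT : 0 < T)
    (Y : Ω → ℝ)
    (hnn : ∀ᵐ ω ∂P, 0 ≤ Y ω)
    (hint : Integrable Y P)
    (hint2 : Integrable (fun ω => (Y ω) ^ 2) P)
    (hmean : Real.sqrt T ≤ ∫ ω, Y ω ∂P)
    (hvar : variance Y P ≤ T) :
    (1 / 2) * Real.sqrt (∫ ω, Y ω ∂P) ≤ ∫ ω, Real.sqrt (Y ω) ∂P := by
  set m := ∫ ω, Y ω ∂P with hm
  have hTs : 0 < Real.sqrt T := Real.sqrt_pos.mpr hT
  have hmpos : 0 < m := lt_of_lt_of_le hTs hmean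
  have hTm : T ≤ m ^ 2 := by
    have h := Real.sq_sqrt hT.le
    nlinarith
  have hvar' : ∫ ω, (Y ω - m) ^ 2 ∂P ≤ T := by
    rwa [variance_eq_integral hint.aemeasurable] at hvar
  set a := Real.sqrt m with ha
  have hapos : 0 < a := Real.sqrt_pos.mpr hmpos
  have ham : a ^ 2 = m := Real.sq_sqrt hmpos.le
  have hsq : Integrable (fun ω => (Y ω - m) ^ 2) P := by
    have h : Integrable (fun ω => (Y ω) ^ 2 - (2 * m) * Y ω + m ^ 2) P :=
      (hint2.sub (hint.const_mul (2 * m))).add (integrable_const _)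
    refine h.congr (Filter.Eventually.of_forall fun ω => ?_)
    ring
  have hsqrt : Integrable (fun ω => Real.sqrt (Y ω)) P := by
    refine Integrable.mono' (hint.add (integrable_const (1 : ℝ)))
      (Real.continuous_sqrt.comp_aestronglyMeasurable hint.aestronglyMeasurable) ?_
    filter_upwards [hnn] with ω hω
    have h := Real.sq_sqrt hω
    rw [Real.norm_eq_abs, abs_of_nonneg (Real.sqrt_nonneg _)]
    simp only [Pi.add_apply]
    nlinarith [sq_nonneg (Real.sqrt (Y ω) - 1), Real.sqrt_nonneg (Y ω)]
  have hlin : Integrable (fun ω => (2 * a ^ 4 - a ^ 2 * m) + a ^ 2 * Y ω) P :=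
    (integrable_const _).add (hint.const_mul _)
  have key : ∫ ω, ((2 * a ^ 4 - a ^ 2 * m) + a ^ 2 * Y ω) - (Y ω - m) ^ 2 ∂P
      ≤ ∫ ω, (2 * a ^ 3) * Real.sqrt (Y ω) ∂P := by
    refine integral_mono_ae (hlin.sub hsq) (hsqrt.const_mul _) ?_
    filter_upwards [hnn] with ω hω
    have h := Real.sq_sqrt hω
    have hr := Real.sqrt_nonneg (Y ω)
    generalize Real.sqrt (Y ω) = r at h hr
    simp only [← h, ← ham]
    have h1 : 0 ≤ (r - a) ^ 2 * (r ^ 2 + 2 * r * a) := by positivity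
    nlinarith
  rw [integral_sub hlin hsq, integral_add (integrable_const _) (hint.const_mul _),
    integral_const_mul, integral_const_mul, integral_const, ← hm] at key
  simp only [probReal_univ, one_smul] at key
  have ha4 : m ^ 2 = a ^ 4 := by rw [← ham]; ring
  have h3 : 0 < 2 * a ^ 3 := by positivity
  refine le_of_mul_le_mul_left ?_ h3
  refine le_trans ?_ key
  nlinarith
end

section
/- Let K ≥ 2 be an integer and let X₁, …, X_K be integrable real random variables with means μ_i = E[X_i]. Define g(i,j) = μ_i + E[ max{X_i, μ_j} ] for ordered pairs of distinct indices i ≠ j. Suppose (i*, j*) with i* ≠ j* maximizes g over all ordered pairs of distinct indices, and suppose P( X_{i*} < μ_{j*} ) > 0. Then μ_{j*} ≥ μ_j for every index j ≠ i*. -/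
open MeasureTheory

/-- **Proposition C.2.** Let `X 1, …, X K` be integrable arms with means
`μ i = E[X i]`, and let `g (i,j) = μ i + E[max (X i) (μ j)]`.  If the ordered
pair `(i*, j*)` of distinct indices maximizes `g` and `P(X i* < μ j*) > 0`,
then `μ j* ≥ μ j` for every `j ≠ i*`: the second arm of the two-agent socially
optimal algorithm `2OPT` has the highest mean among the remaining arms. -/
theorem stmt_16
    {Ω : Type*} [MeasurableSpace Ω] (P : Measure Ω) [IsProbabilityMeasure P]
    (K : ℕ) (hK : 2 ≤ K)
    (X : Fin K → Ω → ℝ)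
    (hint : ∀ i, Integrable (X i) P)
    (istar jstar : Fin K) (hne : istar ≠ jstar)
    (hmax : ∀ i j : Fin K, i ≠ j →
      (∫ ω, X i ω ∂P) + ∫ ω, max (X i ω) (∫ ω', X j ω' ∂P) ∂P ≤
        (∫ ω, X istar ω ∂P) +
          ∫ ω, max (X istar ω) (∫ ω', X jstar ω' ∂P) ∂P)
    (hpos : 0 < P {ω | X istar ω < ∫ ω', X jstar ω' ∂P}) :
    ∀ j : Fin K, j ≠ istar → (∫ ω, X j ω ∂P) ≤ ∫ ω, X jstar ω ∂P := by
  intro j hj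
  by_contra! hlt
  have h := hmax istar j hj.symm
  generalize (∫ ω, X j ω ∂P) = b at *
  generalize (∫ ω, X jstar ω ∂P) = a at *
  have ib : Integrable (fun ω => max (X istar ω) b) P := (hint istar).sup (integrable_const b)
  have ia : Integrable (fun ω => max (X istar ω) a) P := (hint istar).sup (integrable_const a)
  have hnn : 0 ≤ fun ω => max (X istar ω) b - max (X istar ω) a := by
    intro ω
    exact sub_nonneg.2 (max_le_max le_rfl hlt.le)
  have h0 : ∫ ω, (max (X istar ω) b - max (X istar ω) a) ∂P = 0 := by
    apply le_antisymm
    · rw [integral_sub ib ia]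
      linarith
    · exact integral_nonneg hnn
  rw [integral_eq_zero_iff_of_nonneg hnn (ib.sub ia)] at h0
  have hz : P {ω | X istar ω < a} = 0 := by
    have h1 : ∀ᵐ ω ∂P, ¬ X istar ω < a := by
      filter_upwards [h0] with ω hω hx
      have h2 : max (X istar ω) b - max (X istar ω) a = 0 := hω
      rw [max_eq_right hx.le, max_eq_right (hx.trans hlt).le] at h2
      linarith
    simpa [ae_iff] using h1
  exact hpos.ne' hz
end
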